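/- Let G be a finite simple graph with edge labels f taking values in ZMod 2, let a, b be distinct vertices, and let A be a set of vertices with a ∉ A and b ∉ A. Suppose there exists a path p from a to b in G avoiding every vertex of A. Define f' by flipping f on exactly the edges of p (f'(e) = f(e) + 1 for e on p, f'(e) = f(e) otherwise). Then: (i) f' agrees with f on every edge incident to a vertex of A; (ii) σ_{f'}(v) = σ_f(v) for every vertex v ∉ {a, b}; and (iii) σ_{f'}(a) = σ_f(a) + 1 ≠ σ_f(a). (Security of the scheme M₀ against non-strongest attacks: two key assignments consistent with everything Eve observes — all the keys on edges incident to compromised nodes and all announcements of intermediate nodes — can yield different values of Alice's key k_A.) -/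

import Mathlib

open scoped Classical

/-- The announcement of node `v`: the XOR (sum in `ZMod 2`) of the keys `f e`
over all edges `e` of `G` incident to `v`. -/
noncomputable def announcement {V : Type*} [Fintype V]
    (G : SimpleGraph V) (f : Sym2 V → ZMod 2) (v : V) : ZMod 2 :=
  ∑ e ∈ G.edgeFinset.filter (fun e => v ∈ e), f e

theorem announcement_flip {V : Type*} [Fintype V] (G : SimpleGraph V)
    (a b : V) (f : Sym2 V → ZMod 2) (p : G.Walk a b) (hp : p.IsPath) (v : V) :
    announcement G (fun e => if e ∈ p.edges then f e + 1 else f e) v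
      = announcement G f v + ((p.edges.countP (fun e => v ∈ e) : ℕ) : ZMod 2) := by
  have h1 : (p.edges.countP (fun e => v ∈ e))
      = ((G.edgeFinset.filter (fun e => v ∈ e)).filter (fun e => e ∈ p.edges)).card := by
    rw [List.countP_eq_length_filter,
      ← List.toFinset_card_of_nodup (hp.isTrail.edges_nodup.filter _)]
    congr 1
    ext e
    simp only [List.mem_toFinset, List.mem_filter, Finset.mem_filter,
      SimpleGraph.mem_edgeFinset, decide_eq_true_eq]
    constructor
    · rintro ⟨h, h'⟩
      exact ⟨⟨p.edges_subset_edgeSet h, h'⟩, h⟩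
    · rintro ⟨⟨_, h'⟩, h⟩
      exact ⟨h, h'⟩
  rw [h1, ← Finset.sum_boole]
  unfold announcement
  rw [← Finset.sum_add_distrib]
  refine Finset.sum_congr rfl fun e _ => ?_
  split_ifs <;> simp <;> assumption

/-- **Security of the scheme `M₀` against non-strongest attacks.** Let `p` be a path
from Alice `a` to Bob `b` avoiding every compromised vertex of `A`, and let `f'` be
obtained from the key assignment `f` by flipping the bit on exactly the edges of `p`.
Then (i) `f'` agrees with `f` on every edge incident to a vertex of `A`;
(ii) all announcements of intermediate nodes `v ∉ {a, b}` are unchanged; and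
(iii) Alice's key `σ_{f'}(a) = σ_f(a) + 1` differs from `σ_f(a)`. -/
theorem m0_secure_of_not_strongest {V : Type*} [Fintype V] (G : SimpleGraph V)
    (a b : V) (hab : a ≠ b) (A : Set V) (ha : a ∉ A) (hb : b ∉ A)
    (f : Sym2 V → ZMod 2) (p : G.Walk a b) (hp : p.IsPath)
    (hpA : ∀ v ∈ A, v ∉ p.support) :
    ∀ f' : Sym2 V → ZMod 2,
      (f' = fun e => if e ∈ p.edges then f e + 1 else f e) →
      (∀ e : Sym2 V, (∃ v ∈ A, v ∈ e) → f' e = f e)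
      ∧ (∀ v : V, v ≠ a → v ≠ b → announcement G f' v = announcement G f v)
      ∧ announcement G f' a = announcement G f a + 1
      ∧ announcement G f' a ≠ announcement G f a := by
  rintro f' rfl
  have key : announcement G (fun e => if e ∈ p.edges then f e + 1 else f e) a
      = announcement G f a + 1 := by
    rw [announcement_flip G a b f p hp a]
    congr 1
    rw [ZMod.natCast_eq_one_iff_odd, ← Nat.not_even_iff_odd,
      hp.isTrail.even_countP_edges_iff a]
    simp [hab]
  refine ⟨?_, ?_, key, ?_⟩
  · rintro e ⟨v, hv, hve⟩
    have : e ∉ p.edges := fun he => hpA v hv (p.mem_support_of_mem_edges he hve)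
    simp [this]
  · intro v hva hvb
    rw [announcement_flip G a b f p hp v]
    have : Even (p.edges.countP (fun e => v ∈ e)) :=
      (hp.isTrail.even_countP_edges_iff v).2 fun _ => ⟨hva, hvb⟩
    rw [(ZMod.natCast_eq_zero_iff_even).2 this, add_zero]
  · rw [key]
    simp
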